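/- arXiv:2410.14936 — 4 statements merged into one kernel-verified Lean document; each statement's English description precedes it below -/
import Mathlib

section
/- Let c : ℝⁿ → ℝ and F₁,…,Fₘ : ℝⁿ → ℝ be convex functions, write F(i) = (F₁(i),…,Fₘ(i)) and L(i, λ) = c(i) + ⟨λ, F(i)⟩. Suppose (i*, λ*) is a KKT pair: λ* ≥ 0 componentwise, F(i*) ≤ 0 componentwise, ⟨λ*, F(i*)⟩ = 0, and i* minimizes i ↦ L(i, λ*) over ℝⁿ. Then for every i ∈ ℝⁿ, every λ ∈ ℝᵐ with λ ≥ 0, every subgradient s_c ∈ ∂c(i), and subgradients sⱼ ∈ ∂Fⱼ(i) for each j, the vector ψ = (s_c + Σⱼ λⱼ sⱼ, −F(i)) ∈ ℝⁿ × ℝᵐ satisfies ⟨ψ, (i, λ) − (i*, λ*)⟩ ≥ L(i, λ*) − L(i*, λ*) ≥ 0. -/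
open scoped RealInnerProductSpace

theorem real_inner_eq_mul (x y : ℝ) : ⟪x, y⟫ = x * y := by
  simp [mul_comm]

/-- For a KKT pair `(i*, λ*)` of the convex problem `min c(i)` s.t. `F(i) ≤ 0`, any
primal-dual (sub)gradient vector `ψ = (s_c + Σⱼ λⱼ sⱼ, −F(i))` of the Lagrangian satisfies
`⟨ψ, (i, λ) − (i*, λ*)⟩ ≥ L(i, λ*) − L(i*, λ*) ≥ 0`. -/
theorem kkt_saddle_subgradient_inequality {n m : ℕ}
    (c : EuclideanSpace ℝ (Fin n) → ℝ)
    (F : EuclideanSpace ℝ (Fin n) → EuclideanSpace ℝ (Fin m))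
    (hc : ConvexOn ℝ Set.univ c)
    (hF : ∀ j, ConvexOn ℝ Set.univ (fun i => F i j))
    (L : EuclideanSpace ℝ (Fin n) → EuclideanSpace ℝ (Fin m) → ℝ)
    (hL : ∀ i lam, L i lam = c i + ⟪lam, F i⟫)
    (iStar : EuclideanSpace ℝ (Fin n)) (lamStar : EuclideanSpace ℝ (Fin m))
    (hlamStar_nonneg : ∀ j, 0 ≤ lamStar j)
    (hfeas : ∀ j, F iStar j ≤ 0)
    (hcompl : ⟪lamStar, F iStar⟫ = 0)
    (hmin : ∀ i, L iStar lamStar ≤ L i lamStar) :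
    ∀ (i : EuclideanSpace ℝ (Fin n)) (lam : EuclideanSpace ℝ (Fin m)),
      (∀ j, 0 ≤ lam j) →
      ∀ (sc : EuclideanSpace ℝ (Fin n)),
        (∀ y, c i + ⟪sc, y - i⟫ ≤ c y) →
      ∀ (s : Fin m → EuclideanSpace ℝ (Fin n)),
        (∀ j, ∀ y, F i j + ⟪s j, y - i⟫ ≤ F y j) →
      (⟪sc + ∑ j, lam j • s j, i - iStar⟫ + ⟪-(F i), lam - lamStar⟫
          ≥ L i lamStar - L iStar lamStar)
      ∧ L i lamStar - L iStar lamStar ≥ 0 := by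
  intro i lam hlam sc hsc s hs
  refine ⟨?_, sub_nonneg.mpr (hmin i)⟩
  have hobj : c i - c iStar ≤ ⟪sc, i - iStar⟫ := by
    have h := hsc iStar
    rw [← neg_sub i iStar, inner_neg_right] at h
    linarith
  have hconstr : ⟪lam, F i⟫ - ⟪lam, F iStar⟫ ≤ ⟪∑ j, lam j • s j, i - iStar⟫ := by
    rw [← inner_sub_right, PiLp.inner_apply, sum_inner]
    refine Finset.sum_le_sum fun j _ => ?_
    have h := hs j iStar
    rw [← neg_sub i iStar, inner_neg_right] at h
    rw [real_inner_smul_left, real_inner_eq_mul, PiLp.sub_apply]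
    exact mul_le_mul_of_nonneg_left (by linarith) (hlam j)
  have hsign : ⟪lam, F iStar⟫ ≤ 0 := by
    rw [PiLp.inner_apply]
    refine Finset.sum_nonpos fun j _ => ?_
    rw [real_inner_eq_mul]
    exact mul_nonpos_of_nonneg_of_nonpos (hlam j) (hfeas j)
  rw [hL, hL, hcompl, inner_add_left, inner_neg_left, inner_sub_right (F i),
    real_inner_comm lam (F i), real_inner_comm lamStar (F i)]
  linarith
end

section
/- Let H be a real inner product space, z* ∈ H, and let (z⁽ᵏ⁾)_{k≥1}, (ψ⁽ᵏ⁾)_{k≥1} be sequences in H with ψ⁽ᵏ⁾ ≠ 0 for all k, and (γₖ)_{k≥1} positive reals with Σₖ γₖ² ≤ S < ∞. Suppose the iterates satisfy the normalized update z⁽ᵏ⁺¹⁾ = z⁽ᵏ⁾ − (γₖ/‖ψ⁽ᵏ⁾‖) ψ⁽ᵏ⁾ and the alignment condition ⟨ψ⁽ᵏ⁾, z⁽ᵏ⁾ − z*⟩ ≥ 0 for all k, and that ‖z⁽¹⁾‖ ≤ A and ‖z*‖ ≤ A. Then for every k, ‖z⁽ᵏ⁾ − z*‖² ≤ 4A²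 + S, and consequently ‖z⁽ᵏ⁾‖ ≤ A + √(4A² + S). -/
open scoped RealInnerProductSpace

/-- A step of length at most `γ` against a direction `ψ` that is aligned with `x` increases the
squared norm of `x` by at most `γ ^ 2`. -/
theorem norm_sub_normalized_smul_sq_le {H : Type*} [NormedAddCommGroup H]
    [InnerProductSpace ℝ H] {x ψ : H} {γ : ℝ} (hγ : 0 ≤ γ) (h : 0 ≤ ⟪ψ, x⟫) :
    ‖x - (γ / ‖ψ‖) • ψ‖ ^ 2 ≤ ‖x‖ ^ 2 + γ ^ 2 := by
  have hstep : ‖(γ / ‖ψ‖) • ψ‖ ≤ γ := by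
    rw [norm_smul, Real.norm_of_nonneg (by positivity)]
    rcases eq_or_ne ‖ψ‖ 0 with h0 | h0
    · simpa [h0] using hγ
    · exact (div_mul_cancel₀ γ h0).le
  have hsq := pow_le_pow_left₀ (norm_nonneg _) hstep 2
  have hinner : 0 ≤ ⟪x, (γ / ‖ψ‖) • ψ⟫ := by
    rw [real_inner_smul_right, real_inner_comm]
    positivity
  rw [norm_sub_sq_real]
  linarith

/-- Boundedness of the normalized primal-dual iterates: if
`z⁽ᵏ⁺¹⁾ = z⁽ᵏ⁾ − (γₖ/‖ψ⁽ᵏ⁾‖) ψ⁽ᵏ⁾` with `⟨ψ⁽ᵏ⁾, z⁽ᵏ⁾ − z*⟩ ≥ 0`, `Σ γₖ² ≤ S`,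
`‖z⁽¹⁾‖ ≤ A` and `‖z*‖ ≤ A`, then `‖z⁽ᵏ⁾ − z*‖² ≤ 4A² + S` and
`‖z⁽ᵏ⁾‖ ≤ A + √(4A² + S)` for every `k ≥ 1`. -/
theorem foio_iterates_bounded {H : Type*} [NormedAddCommGroup H] [InnerProductSpace ℝ H]
    (zStar : H) (z ψ : ℕ → H) (γ : ℕ → ℝ) (S A : ℝ)
    (hψ_ne : ∀ k ≥ 1, ψ k ≠ 0)
    (hγ_pos : ∀ k ≥ 1, 0 < γ k)
    (hγ_sq_summable : Summable (fun k => (γ k) ^ 2))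
    (hγ_sq_sum : ∑' k, (γ k) ^ 2 ≤ S)
    (hupdate : ∀ k ≥ 1, z (k + 1) = z k - (γ k / ‖ψ k‖) • ψ k)
    (halign : ∀ k ≥ 1, 0 ≤ ⟪ψ k, z k - zStar⟫)
    (hz1 : ‖z 1‖ ≤ A) (hzStar : ‖zStar‖ ≤ A) :
    ∀ k ≥ 1, ‖z k - zStar‖ ^ 2 ≤ 4 * A ^ 2 + S ∧
      ‖z k‖ ≤ A + Real.sqrt (4 * A ^ 2 + S) := by
  have hdist : ∀ k ≥ 1,
      ‖z k - zStar‖ ^ 2 ≤ 4 * A ^ 2 + ∑ i ∈ Finset.range k, γ i ^ 2 := by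
    intro k hk
    induction k, hk using Nat.le_induction with
    | base =>
      have hle : ‖z 1 - zStar‖ ≤ 2 * A := by linarith [norm_sub_le (z 1) zStar]
      have hsq := pow_le_pow_left₀ (norm_nonneg _) hle 2
      rw [Finset.sum_range_one]
      nlinarith [sq_nonneg (γ 0)]
    | succ k hk ih =>
      have hle := norm_sub_normalized_smul_sq_le (hγ_pos k hk).le (halign k hk)
      rw [hupdate k hk, sub_right_comm, Finset.sum_range_succ]
      linarith
  intro k hk
  have hsum := hγ_sq_summable.sum_le_tsum (Finset.range k) fun i _ => sq_nonneg (γ i)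
  have hbound : ‖z k - zStar‖ ^ 2 ≤ 4 * A ^ 2 + S := by linarith [hdist k hk]
  refine ⟨hbound, ?_⟩
  linarith [Real.le_sqrt_of_sq_le hbound, norm_le_norm_add_norm_sub' (z k) zStar]
end

section
/- Let H be a real inner product space, z* ∈ H, and let (z⁽ᵏ⁾)_{k≥1}, (ψ⁽ᵏ⁾)_{k≥1} be sequences in H with ψ⁽ᵏ⁾ ≠ 0, and (γₖ)_{k≥1} positive reals with Σₖ γₖ = ∞ and Σₖ γₖ² ≤ S < ∞. Suppose z⁽ᵏ⁺¹⁾ = z⁽ᵏ⁾ − (γₖ/‖ψ⁽ᵏ⁾‖) ψ⁽ᵏ⁾, that aₖ := ⟨ψ⁽ᵏ⁾, z⁽ᵏ⁾ − z*⟩ ≥ 0 for all k, that ‖z⁽¹⁾‖ ≤ A and ‖z*‖ ≤ A, and that sup_k ‖ψ⁽ᵏ⁾‖ ≤ G < ∞. Then liminf_{k→∞} aₖ = 0; in particular, if additionally aₖ ≥ L(i⁽ᵏ⁾, λ*) − L(i*, λ*) ≥ 0 for all k for some functions L evaluated along the iterates, then liminf_{k→∞} L(i⁽ᵏ⁾,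 λ*) = L(i*, λ*). -/
open scoped RealInnerProductSpace

/-- A real sequence which is eventually at least `c` and frequently below every `c + ε` has
limit inferior `c`. -/
theorem liminf_eq_of_eventually_le_of_frequently_lt {u : ℕ → ℝ} {c : ℝ}
    (hle : ∀ᶠ k in Filter.atTop, c ≤ u k)
    (hlt : ∀ ε > 0, ∃ᶠ k in Filter.atTop, u k < c + ε) :
    Filter.liminf u Filter.atTop = c := by
  rw [Filter.liminf_eq]
  refine IsGreatest.csSup_eq ⟨hle, fun b hb => ?_⟩
  by_contra! hcb
  obtain ⟨k, hk, hbk⟩ := ((hlt (b - c) (sub_pos.2 hcb)).and_eventually hb).exists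
  linarith

/-- One normalized subgradient step changes the squared distance to `w` by
`γ ^ 2 - 2 * (γ / ‖p‖) * ⟪p, x - w⟫`. -/
theorem norm_sub_normalized_step_sq {H : Type*} [NormedAddCommGroup H] [InnerProductSpace ℝ H]
    (x w : H) {p : H} (hp : p ≠ 0) (γ : ℝ) :
    ‖x - (γ / ‖p‖) • p - w‖ ^ 2 = ‖x - w‖ ^ 2 - 2 * (γ / ‖p‖ * ⟪p, x - w⟫) + γ ^ 2 := by
  have hp' : ‖p‖ ≠ 0 := norm_ne_zero_iff.2 hp
  rw [sub_right_comm, norm_sub_sq_real, real_inner_smul_right, real_inner_comm, norm_smul,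
    mul_pow, Real.norm_eq_abs, sq_abs, div_pow, div_mul_cancel₀ _ (pow_ne_zero 2 hp')]

/-- If nonnegative `d` and `b` satisfy `d (k + 1) = d k - b k + e k` with `e` nonnegative and
summable, then `b` is summable. -/
theorem summable_of_recurrence {d b e : ℕ → ℝ} (hd : ∀ k, 0 ≤ d k) (hb : ∀ k, 0 ≤ b k)
    (he : ∀ k, 0 ≤ e k) (hsum : Summable e) (hstep : ∀ k, d (k + 1) = d k - b k + e k) :
    Summable b := by
  refine summable_of_sum_range_le (c := d 0 + ∑' k, e k) hb fun n => ?_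
  have htel : d n + ∑ k ∈ Finset.range n, b k = d 0 + ∑ k ∈ Finset.range n, e k := by
    induction n with
    | zero => simp
    | succ n ih => rw [Finset.sum_range_succ, Finset.sum_range_succ, hstep]; linarith
  have htail := hsum.sum_le_tsum (Finset.range n) fun k _ => he k
  linarith [hd n]

/-- Core convergence step of FOIO: with normalized step sizes `γₖ/‖ψ⁽ᵏ⁾‖` where `γₖ` is
square summable but not summable, nonnegative alignment terms `aₖ = ⟨ψ⁽ᵏ⁾, z⁽ᵏ⁾ − z*⟩`,
bounded iterates and uniformly bounded `‖ψ⁽ᵏ⁾‖ ≤ G`, we get `liminf aₖ = 0`; in particular,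
if moreover `aₖ ≥ L(i⁽ᵏ⁾, λ*) − L(i*, λ*) ≥ 0`, then
`liminf L(i⁽ᵏ⁾, λ*) = L(i*, λ*)`. -/
theorem foio_liminf_convergence {H : Type*} [NormedAddCommGroup H] [InnerProductSpace ℝ H]
    (zStar : H) (z ψ : ℕ → H) (γ : ℕ → ℝ) (S A G : ℝ)
    (a : ℕ → ℝ)
    (ha : ∀ k, a k = ⟪ψ k, z k - zStar⟫)
    (hψ_ne : ∀ k ≥ 1, ψ k ≠ 0)
    (hγ_pos : ∀ k ≥ 1, 0 < γ k)
    (hγ_not_summable : ¬ Summable γ)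
    (hγ_sq_summable : Summable (fun k => (γ k) ^ 2))
    (hγ_sq_sum : ∑' k, (γ k) ^ 2 ≤ S)
    (hupdate : ∀ k ≥ 1, z (k + 1) = z k - (γ k / ‖ψ k‖) • ψ k)
    (halign : ∀ k ≥ 1, 0 ≤ a k)
    (hz1 : ‖z 1‖ ≤ A) (hzStar : ‖zStar‖ ≤ A)
    (hG : ∀ k ≥ 1, ‖ψ k‖ ≤ G)
    -- Lagrangian values along the iterates and at the optimum
    (Lvals : ℕ → ℝ) (LStar : ℝ)
    (hLvals : ∀ k ≥ 1, Lvals k - LStar ≤ a k ∧ 0 ≤ Lvals k - LStar) :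
    Filter.liminf a Filter.atTop = 0 ∧
      Filter.liminf Lvals Filter.atTop = LStar := by
  have hsum : Summable fun k => 2 * (γ (k + 1) / ‖ψ (k + 1)‖ * a (k + 1)) := by
    refine summable_of_recurrence (d := fun k => ‖z (k + 1) - zStar‖ ^ 2)
      (e := fun k => γ (k + 1) ^ 2) (fun k => by positivity) (fun k => ?_)
      (fun k => by positivity) ((summable_nat_add_iff 1).2 hγ_sq_summable) fun k => ?_
    · have h1 := hγ_pos (k + 1) (by omega)
      have h2 := halign (k + 1) (by omega)
      positivity
    · have hk : k + 1 ≥ 1 := by omega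
      simp only [hupdate (k + 1) hk, ha (k + 1)]
      exact norm_sub_normalized_step_sq _ _ (hψ_ne _ hk) _
  have hG_pos : 0 < G := (norm_pos_iff.2 (hψ_ne 1 le_rfl)).trans_le (hG 1 le_rfl)
  have hfreq : ∀ ε > 0, ∃ᶠ k in Filter.atTop, a k < ε := by
    intro ε hε hev
    obtain ⟨N, hN⟩ := Filter.eventually_atTop.1 hev
    refine hγ_not_summable ((summable_nat_add_iff (N + 1)).1 ?_)
    refine Summable.of_nonneg_of_le (fun k => (hγ_pos _ (by omega)).le) (fun k => ?_)
      (((summable_nat_add_iff N).2 hsum).mul_left (G / (2 * ε)))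
    have hk : k + N + 1 ≥ 1 := by omega
    have hγ := hγ_pos _ hk
    have hψ := norm_pos_iff.2 (hψ_ne _ hk)
    have hε_le : ε ≤ a (k + N + 1) := not_lt.1 (hN _ (by omega))
    have hmul : ε * ‖ψ (k + N + 1)‖ ≤ a (k + N + 1) * G :=
      mul_le_mul hε_le (hG _ hk) hψ.le (halign _ hk)
    change γ (k + N + 1) ≤ _
    calc γ (k + N + 1)
        = γ (k + N + 1) * (ε * ‖ψ (k + N + 1)‖) / (ε * ‖ψ (k + N + 1)‖) := by field_simp
      _ ≤ γ (k + N + 1) * (a (k + N + 1) * G) / (ε * ‖ψ (k + N + 1)‖) := by gcongr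
      _ = G / (2 * ε) * (2 * (γ (k + N + 1) / ‖ψ (k + N + 1)‖ * a (k + N + 1))) := by
        field_simp
  have hge : ∀ᶠ k : ℕ in Filter.atTop, k ≥ 1 := Filter.eventually_ge_atTop 1
  constructor
  · exact liminf_eq_of_eventually_le_of_frequently_lt (hge.mono halign)
      (by simpa only [zero_add] using hfreq)
  · refine liminf_eq_of_eventually_le_of_frequently_lt
      (hge.mono fun k hk => sub_nonneg.1 (hLvals k hk).2) fun ε hε => ?_
    refine ((hfreq ε hε).and_eventually hge).mono fun k ⟨hk, hk1⟩ => ?_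
    linarith [(hLvals k hk1).1]
end

section
/- Let H be a real Hilbert space, K ⊆ H nonempty closed convex with metric projection proj_K. For each k ≥ 1 let ψ⁽ᵏ⁾ : H → H be η-strongly monotone and L-Lipschitz (0 < η ≤ L), let 0 < ε < 2η/L², and set ρ = √(1 − 2εη + ε²L²) < 1. Suppose z*⁽ᵏ⁾ ∈ K satisfy z*⁽ᵏ⁾ = proj_K(z*⁽ᵏ⁾ − ε ψ⁽ᵏ⁾(z*⁽ᵏ⁾)) and ‖z*⁽ᵏ⁾ − z*⁽ᵏ⁻¹⁾‖ ≤ ω for all k, and the iterates satisfy z⁽ᵏ⁾ = proj_K(z⁽ᵏ⁻¹⁾ − ε ψ⁽ᵏ⁾(z⁽ᵏ⁻¹⁾)). Then for all k, ‖z⁽ᵏ⁾ − z*⁽ᵏ⁾‖ ≤ ρᵏ ‖z⁽⁰⁾ − z*⁽⁰⁾‖ + ω (1 − ρᵏ)/(1 − ρ), and consequently limsup_{k→∞} ‖z⁽ᵏ⁾ − z*⁽ᵏ⁾‖ ≤ ω/(1 − ρ) = ω/(1 − √(1 − 2εη + ε²L²)). -/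
open scoped RealInnerProductSpace

/-- A nearest point of a convex set satisfies the obtuse angle condition. -/
lemma real_inner_sub_nonpos_of_forall_norm_sub_le
    {H : Type*} [NormedAddCommGroup H] [InnerProductSpace ℝ H] {K : Set H} (hK : Convex ℝ K)
    {x p : H} (hp : p ∈ K) (hmin : ∀ y ∈ K, ‖x - p‖ ≤ ‖x - y‖) {y : H} (hy : y ∈ K) :
    ⟪x - p, y - p⟫ ≤ 0 := by
  have : Nonempty K := ⟨⟨p, hp⟩⟩
  refine (norm_eq_iInf_iff_real_inner_le_zero hK hp).1 (le_antisymm ?_ ?_) y hy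
  · exact le_ciInf fun w => hmin w w.2
  · exact ciInf_le ⟨0, by rintro _ ⟨w, rfl⟩; exact norm_nonneg _⟩ (⟨p, hp⟩ : K)

/-- Nearest points in a convex set depend nonexpansively on the base point. -/
lemma norm_sub_le_of_nearest_points
    {H : Type*} [NormedAddCommGroup H] [InnerProductSpace ℝ H] {K : Set H} (hK : Convex ℝ K)
    {x y p q : H} (hp : p ∈ K) (hq : q ∈ K) (hxp : ∀ w ∈ K, ‖x - p‖ ≤ ‖x - w‖)
    (hyq : ∀ w ∈ K, ‖y - q‖ ≤ ‖y - w‖) :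
    ‖p - q‖ ≤ ‖x - y‖ := by
  have h₁ := real_inner_sub_nonpos_of_forall_norm_sub_le hK hp hxp hq
  have h₂ := real_inner_sub_nonpos_of_forall_norm_sub_le hK hq hyq hp
  have hsum : ⟪x - y, p - q⟫ - ⟪p - q, p - q⟫ = -⟪x - p, q - p⟫ - ⟪y - q, p - q⟫ := by
    simp only [inner_sub_left, inner_sub_right]
    ring
  have hcs := real_inner_le_norm (x - y) (p - q)
  rw [real_inner_self_eq_norm_sq] at hsum
  by_contra! hlt
  nlinarith [norm_nonneg (x - y)]

/-- A forward step along a strongly monotone Lipschitz operator contracts distances. -/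
lemma norm_forward_step_sub_le
    {H : Type*} [NormedAddCommGroup H] [InnerProductSpace ℝ H] {ψ : H → H} {η L ε : ℝ}
    (hε : 0 ≤ ε) {x y : H} (hmono : η * ‖x - y‖ ^ 2 ≤ ⟪ψ x - ψ y, x - y⟫)
    (hlip : ‖ψ x - ψ y‖ ≤ L * ‖x - y‖) :
    ‖(x - ε • ψ x) - (y - ε • ψ y)‖
      ≤ Real.sqrt (1 - 2 * ε * η + ε ^ 2 * L ^ 2) * ‖x - y‖ := by
  have hsq : ‖(x - ε • ψ x) - (y - ε • ψ y)‖ ^ 2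
      ≤ (1 - 2 * ε * η + ε ^ 2 * L ^ 2) * ‖x - y‖ ^ 2 := by
    have heq : (x - ε • ψ x) - (y - ε • ψ y) = (x - y) - ε • (ψ x - ψ y) := by
      rw [smul_sub]
      abel
    rw [heq, norm_sub_sq_real, real_inner_smul_right, norm_smul, Real.norm_of_nonneg hε,
      real_inner_comm]
    have hlip_sq : ‖ψ x - ψ y‖ ^ 2 ≤ (L * ‖x - y‖) ^ 2 :=
      pow_le_pow_left₀ (norm_nonneg _) hlip 2
    nlinarith [mul_le_mul_of_nonneg_left hmono hε,
      mul_le_mul_of_nonneg_left hlip_sq (sq_nonneg ε)]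
  rw [← Real.sqrt_sq (norm_nonneg (x - y)), ← Real.sqrt_mul' _ (sq_nonneg _)]
  exact Real.le_sqrt_of_sq_le hsq

/-- Discrete Grönwall bound for a contractive recursion with constant perturbation. -/
lemma le_pow_mul_add_of_le_mul_add {e : ℕ → ℝ} {ρ ω : ℝ} (hρ : 0 ≤ ρ) (hρ_lt : ρ < 1)
    (hstep : ∀ k, e (k + 1) ≤ ρ * e k + ω) (k : ℕ) :
    e k ≤ ρ ^ k * e 0 + ω * (1 - ρ ^ k) / (1 - ρ) := by
  have hne : 1 - ρ ≠ 0 := by linarith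
  induction k with
  | zero => simp
  | succ k ih =>
    calc e (k + 1) ≤ ρ * e k + ω := hstep k
      _ ≤ ρ * (ρ ^ k * e 0 + ω * (1 - ρ ^ k) / (1 - ρ)) + ω := by gcongr
      _ = ρ ^ (k + 1) * e 0 + ω * (1 - ρ ^ (k + 1)) / (1 - ρ) := by
        field_simp
        ring

/-- Tracking theorem for FOIO in the time-varying setting: projected iterates driven by
time-varying strongly monotone Lipschitz operators track the time-varying fixed points
`z*⁽ᵏ⁾` up to the asymptotic error `ω/(1 − ρ)`. -/
theorem foio_time_varying_tracking
    {H : Type*} [NormedAddCommGroup H] [InnerProductSpace ℝ H] [CompleteSpace H]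
    (K : Set H) (hK_ne : K.Nonempty) (hK_closed : IsClosed K) (hK_convex : Convex ℝ K)
    (projK : H → H)
    (hprojK_mem : ∀ x, projK x ∈ K)
    (hprojK_dist : ∀ x, ∀ y ∈ K, ‖x - projK x‖ ≤ ‖x - y‖)
    (ψ : ℕ → H → H) (η L : ℝ) (hη : 0 < η) (hηL : η ≤ L)
    (hmono : ∀ k ≥ 1, ∀ z z' : H, η * ‖z - z'‖ ^ 2 ≤ ⟪ψ k z - ψ k z', z - z'⟫)
    (hlip : ∀ k ≥ 1, ∀ z z' : H, ‖ψ k z - ψ k z'‖ ≤ L * ‖z - z'‖)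
    (ε ρ : ℝ) (hε_pos : 0 < ε) (hε_lt : ε < 2 * η / L ^ 2)
    (hρ : ρ = Real.sqrt (1 - 2 * ε * η + ε ^ 2 * L ^ 2))
    (zStar : ℕ → H) (ω : ℝ)
    (hzStar_mem : ∀ k, zStar k ∈ K)
    (hfix : ∀ k ≥ 1, zStar k = projK (zStar k - ε • ψ k (zStar k)))
    (hdrift : ∀ k ≥ 1, ‖zStar k - zStar (k - 1)‖ ≤ ω)
    (z : ℕ → H)
    (hupdate : ∀ k ≥ 1, z k = projK (z (k - 1) - ε • ψ k (z (k - 1)))) :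
    (∀ k : ℕ, ‖z k - zStar k‖ ≤ ρ ^ k * ‖z 0 - zStar 0‖ + ω * (1 - ρ ^ k) / (1 - ρ))
    ∧ Filter.limsup (fun k => ‖z k - zStar k‖) Filter.atTop
        ≤ ω / (1 - Real.sqrt (1 - 2 * ε * η + ε ^ 2 * L ^ 2)) := by
  have hρ_nonneg : 0 ≤ ρ := hρ ▸ Real.sqrt_nonneg _
  have hρ_lt : ρ < 1 := by
    rw [hρ, Real.sqrt_lt' one_pos]
    have hL : 0 < L := hη.trans_le hηL
    rw [lt_div_iff₀ (by positivity)] at hε_lt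
    nlinarith [mul_lt_mul_of_pos_left hε_lt hε_pos]
  have hω : 0 ≤ ω := (norm_nonneg _).trans (hdrift 1 le_rfl)
  have hstep : ∀ k, ‖z (k + 1) - zStar (k + 1)‖ ≤ ρ * ‖z k - zStar k‖ + ω := by
    intro k
    have hk : k + 1 ≥ 1 := Nat.le_add_left 1 k
    have hz := hupdate (k + 1) hk
    have hd := hdrift (k + 1) hk
    rw [Nat.add_sub_cancel] at hz hd
    have hcontr : ‖z (k + 1) - zStar (k + 1)‖ ≤ ρ * ‖z k - zStar (k + 1)‖ := by
      rw [hz, hρ]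
      nth_rewrite 1 [hfix (k + 1) hk]
      exact (norm_sub_le_of_nearest_points hK_convex (hprojK_mem _) (hprojK_mem _)
        (hprojK_dist _) (hprojK_dist _)).trans
        (norm_forward_step_sub_le hε_pos.le (hmono _ hk _ _) (hlip _ hk _ _))
    have htri : ‖z k - zStar (k + 1)‖ ≤ ‖z k - zStar k‖ + ω := by
      refine (norm_sub_le_norm_sub_add_norm_sub _ (zStar k) _).trans ?_
      rw [norm_sub_rev (zStar k)]
      gcongr
    nlinarith [mul_le_mul_of_nonneg_left htri hρ_nonneg]
  have hbound := le_pow_mul_add_of_le_mul_add (e := fun k => ‖z k - zStar k‖)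
    hρ_nonneg hρ_lt hstep
  refine ⟨hbound, ?_⟩
  rw [← hρ]
  have hpow := tendsto_pow_atTop_nhds_zero_of_lt_one hρ_nonneg hρ_lt
  have hlim : Filter.Tendsto
      (fun k : ℕ => ρ ^ k * ‖z 0 - zStar 0‖ + ω * (1 - ρ ^ k) / (1 - ρ))
      Filter.atTop (nhds (ω / (1 - ρ))) := by
    simpa using (hpow.mul_const ‖z 0 - zStar 0‖).add
      (((hpow.const_sub 1).const_mul ω).div_const (1 - ρ))
  rw [← hlim.limsup_eq]
  exact Filter.limsup_le_limsup (Filter.Eventually.of_forall hbound)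
    (Filter.isCoboundedUnder_le_of_le Filter.atTop fun k => norm_nonneg (z k - zStar k))
    hlim.isBoundedUnder_le
end
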